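/- Consider compact metric pairs (X_i,A_i) converging in the Gromov–Hausdorff sense to (X_∞,A_∞) and (Y_i,B_i) converging in the Gromov–Hausdorff sense to (Y_∞,B_∞), and equicontinuous relative maps f_i : (X_i,A_i) → (Y_i,B_i) for all i ∈ ℕ. Then there exists a subsequence of {f_i} converging (relatively uniformly, via isometric embeddings of all pairs into common ambient metric pairs realizing the GH convergence) to a continuous relative map f_∞ : (X_∞,A_∞) → (Y_∞,B_∞). Moreover, if Lip(f_i) ≤ K for all i ∈ ℕ then Lip(f_∞) ≤ K, and if Lip(f_i|_{A_i}) ≤ L for all i ∈ ℕ then Lip(f_∞|_{A_∞}) ≤ L. -/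

import Mathlib

open Metric Set

/-- An admissible metric on the disjoint union of two metric spaces: a metric on `X ⊕ Y`
restricting to the given metrics on `X` and on `Y`. -/
structure AdmissibleMetric (X Y : Type*) [MetricSpace X] [MetricSpace Y] where
  d : (X ⊕ Y) → (X ⊕ Y) → ℝ
  refl : ∀ p, d p p = 0
  pos : ∀ p q, p ≠ q → 0 < d p q
  symm : ∀ p q, d p q = d q p
  triangle : ∀ p q r, d p r ≤ d p q + d q r
  restr_left : ∀ x x' : X, d (.inl x) (.inl x') = dist x x'
  restr_right : ∀ y y' : Y, d (.inr y) (.inr y') = dist y y'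

/-- Hausdorff distance between two subsets with respect to an abstract distance function. -/
noncomputable def hausdorffDistWrt {Z : Type*} (d : Z → Z → ℝ) (S T : Set Z) : ℝ :=
  max (⨆ s : S, ⨅ t : T, d s t) (⨆ t : T, ⨅ s : S, d s t)

/-- Hausdorff distance between the pairs `(X, A)` and `(Y, B)` inside `X ⊕ Y`,
with respect to a distance function on `X ⊕ Y`:
`d_H^δ((X,A),(Y,B)) = d_H^δ(X,Y) + d_H^δ(A,B)`. -/
noncomputable def pairHausdorffDistWrt {X Y : Type*} [MetricSpace X] [MetricSpace Y]
    (d : (X ⊕ Y) → (X ⊕ Y) → ℝ) (A : Set X) (B : Set Y) : ℝ :=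
  hausdorffDistWrt d (Set.range Sum.inl) (Set.range Sum.inr)
    + hausdorffDistWrt d (Sum.inl '' A) (Sum.inr '' B)

/-- Hausdorff distance between pairs with respect to an admissible metric. -/
noncomputable def pairHausdorffDist {X Y : Type*} [MetricSpace X] [MetricSpace Y]
    (δ : AdmissibleMetric X Y) (A : Set X) (B : Set Y) : ℝ :=
  pairHausdorffDistWrt δ.d A B

/-- The Gromov–Hausdorff distance between the metric pairs `(X, A)` and `(Y, B)`:
the infimum of the pair Hausdorff distances over all admissible metrics on `X ⊕ Y`. -/
noncomputable def pairGHDist {X Y : Type*} [MetricSpace X] [MetricSpace Y]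
    (A : Set X) (B : Set Y) : ℝ :=
  sInf {r | ∃ δ : AdmissibleMetric X Y, r = pairHausdorffDist δ A B}

/-- A pair correspondence between `(X, A)` and `(Y, B)`: a correspondence between `X` and `Y`
whose restriction to `A × B` is a correspondence between `A` and `B`. -/
structure IsPairCorrespondence {X Y : Type*} (R : Set (X × Y)) (A : Set X) (B : Set Y) : Prop where
  ex_right : ∀ x : X, ∃ y : Y, (x, y) ∈ R
  ex_left : ∀ y : Y, ∃ x : X, (x, y) ∈ R
  ex_right_pair : ∀ a ∈ A, ∃ b ∈ B, (a, b) ∈ R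
  ex_left_pair : ∀ b ∈ B, ∃ a ∈ A, (a, b) ∈ R

/-- The distortion of a pair correspondence:
`dis(R) = ½ (sup_{(x,y),(x',y') ∈ R} |d_X(x,x') − d_Y(y,y')|
          + sup_{(a,b),(a',b') ∈ R ∩ A×B} |d_X(a,a') − d_Y(b,b')|)`. -/
noncomputable def pairDistortion {X Y : Type*} [MetricSpace X] [MetricSpace Y]
    (R : Set (X × Y)) (A : Set X) (B : Set Y) : ℝ :=
  (1 / 2) * ((⨆ p : R, ⨆ q : R, |dist (p : X × Y).1 (q : X × Y).1 - dist (p : X × Y).2 (q : X × Y).2|)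
    + (⨆ p : ↥(R ∩ A ×ˢ B), ⨆ q : ↥(R ∩ A ×ˢ B),
        |dist (p : X × Y).1 (q : X × Y).1 - dist (p : X × Y).2 (q : X × Y).2|))
/-- A compact metric pair: a compact metric space together with a nonempty closed subset. -/
structure MetricPair where
  carrier : Type
  [m : MetricSpace carrier]
  [cpt : CompactSpace carrier]
  A : Set carrier
  hne : A.Nonempty
  hcl : IsClosed A

attribute [instance] MetricPair.m MetricPair.cpt

/-- The Gromov–Hausdorff distance between compact metric pairs. -/
noncomputable def MetricPair.ghDist (P Q : MetricPair) : ℝ :=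
  pairGHDist P.A Q.A

/-- A (not necessarily compact) metric pair, used as ambient space for embeddings. -/
structure AmbientPair where
  carrier : Type
  [m : MetricSpace carrier]
  A : Set carrier
  hne : A.Nonempty
  hcl : IsClosed A

attribute [instance] AmbientPair.m

open Filter Topology in
/-- A sequence of maps between compact metric spaces which is asymptotically equicontinuous has a
subsequence converging uniformly to a continuous map. -/
theorem exists_subseq_tendstoUniformly_of_asymptotic_equicontinuous {X Y : Type*} [MetricSpace X]
    [CompactSpace X] [MetricSpace Y] [CompactSpace Y] (g : ℕ → X → Y)
    (hg : ∀ ε : ℝ, 0 < ε → ∃ δ : ℝ, 0 < δ ∧ ∃ N : ℕ, ∀ i, N ≤ i → ∀ x y : X,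
      dist x y < δ → dist (g i x) (g i y) < ε) :
    ∃ ι : ℕ → ℕ, StrictMono ι ∧ ∃ finf : X → Y, Continuous finf ∧
      TendstoUniformly (fun i => g (ι i)) finf atTop := by
  obtain ⟨D, hDc, hDd⟩ := TopologicalSpace.exists_countable_dense X
  have := hDc.to_subtype
  obtain ⟨l, ι, hι, hl⟩ := CompactSpace.tendsto_subseq (fun i => fun d : D => g i d)
  rw [tendsto_pi_nhds] at hl
  have hcauchy : ∀ z, CauchySeq (fun i => g (ι i) z) := by
    intro z
    rw [Metric.cauchySeq_iff']
    intro ε hε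
    obtain ⟨δ, hδ, N, hN⟩ := hg (ε / 4) (by positivity)
    obtain ⟨d, hd, hzd⟩ := hDd.exists_dist_lt z hδ
    obtain ⟨M, hM⟩ := Metric.tendsto_atTop.1 (hl ⟨d, hd⟩) (ε / 4) (by positivity)
    refine ⟨max M N, fun n hn => ?_⟩
    have key : ∀ n, max M N ≤ n → dist (g (ι n) z) (l ⟨d, hd⟩) < ε / 2 := by
      intro n hn
      have h1 := hN (ι n) ((le_of_max_le_right hn).trans (hι.le_apply)) z d hzd
      have h2 : dist (g (ι n) d) (l ⟨d, hd⟩) < ε / 4 := hM n (le_of_max_le_left hn)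
      linarith [dist_triangle (g (ι n) z) (g (ι n) d) (l ⟨d, hd⟩)]
    linarith [key n hn, key _ le_rfl,
      dist_triangle_right (g (ι n) z) (g (ι (max M N)) z) (l ⟨d, hd⟩)]
  choose finf hfinf using fun z => cauchySeq_tendsto_of_complete (hcauchy z)
  have hmod : ∀ ε : ℝ, 0 < ε → ∃ δ : ℝ, 0 < δ ∧ ∃ N : ℕ, (∀ i, N ≤ i → ∀ x y : X,
      dist x y < δ → dist (g (ι i) x) (g (ι i) y) < ε) ∧
      ∀ x y : X, dist x y < δ → dist (finf x) (finf y) ≤ ε := by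
    intro ε hε
    obtain ⟨δ, hδ, N, hN⟩ := hg ε hε
    refine ⟨δ, hδ, N, fun i hi => hN _ (hi.trans hι.le_apply), fun x y hxy => ?_⟩
    refine le_of_tendsto ((hfinf x).dist (hfinf y)) ?_
    filter_upwards [eventually_ge_atTop N] with i hi
    exact (hN _ (hi.trans hι.le_apply) x y hxy).le
  refine ⟨ι, hι, finf, ?_, ?_⟩
  · rw [Metric.continuous_iff]
    intro y ε hε
    obtain ⟨δ, hδ, -, -, h⟩ := hmod (ε / 2) (by positivity)
    exact ⟨δ, hδ, fun x hx => (h x y hx).trans_lt (by linarith)⟩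
  · rw [Metric.tendstoUniformly_iff]
    intro ε hε
    obtain ⟨δ, hδ, N, hN, h⟩ := hmod (ε / 4) (by positivity)
    obtain ⟨t, -, htf, ht⟩ := finite_cover_balls_of_compact (isCompact_univ (X := X)) hδ
    have hev : ∀ᶠ i in atTop, ∀ c ∈ t, dist (g (ι i) c) (finf c) < ε / 4 :=
      (htf.eventually_all).2 fun c _ =>
        (hfinf c).eventually (Metric.ball_mem_nhds _ (by positivity))
    filter_upwards [hev, eventually_ge_atTop N] with i hi hiN z
    obtain ⟨c, hc, hzc⟩ := mem_iUnion₂.1 (ht (mem_univ z))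
    have hzc : dist z c < δ := hzc
    have h1 := hN i hiN z c hzc
    have h2 := hi c hc
    have h3 := h z c hzc
    have h5 := dist_triangle (finf z) (finf c) (g (ι i) z)
    have h6 := dist_triangle_left (finf c) (g (ι i) z) (g (ι i) c)
    rw [dist_comm (g (ι i) c) (g (ι i) z)] at h6
    linarith

/-- If the Hausdorff distances between isometric images of two compact metric pairs are less
than `e`, there is a relative map between the pairs moving points by less than `e`. -/
theorem exists_relative_map_dist_lt {X Y W : Type*} [MetricSpace X] [CompactSpace X]
    [MetricSpace Y] [CompactSpace Y] [MetricSpace W] {φ : X → W} {ψ : Y → W} (hφ : Isometry φ)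
    (hψ : Isometry ψ) {A : Set X} {B : Set Y} (hA : A.Nonempty) (hB : B.Nonempty) {e : ℝ}
    (h : hausdorffDist (range φ) (range ψ) < e) (h' : hausdorffDist (φ '' A) (ψ '' B) < e) :
    ∃ a : X → Y, (∀ x, dist (φ x) (ψ (a x)) < e) ∧ MapsTo a A B := by
  have bφ : Bornology.IsBounded (range φ) := (isCompact_range hφ.continuous).isBounded
  have bψ : Bornology.IsBounded (range ψ) := (isCompact_range hψ.continuous).isBounded
  have hx : ∀ x, ∃ y, dist (φ x) (ψ y) < e ∧ (x ∈ A → y ∈ B) := by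
    intro x
    by_cases hxA : x ∈ A
    · obtain ⟨_, ⟨y, hy, rfl⟩, hd⟩ := exists_dist_lt_of_hausdorffDist_lt (mem_image_of_mem φ hxA) h'
        (hausdorffEDist_ne_top_of_nonempty_of_bounded (hA.image _) (hB.image _)
          (bφ.subset (image_subset_range _ _)) (bψ.subset (image_subset_range _ _)))
      exact ⟨y, hd, fun _ => hy⟩
    · obtain ⟨_, ⟨y, rfl⟩, hd⟩ := exists_dist_lt_of_hausdorffDist_lt (mem_range_self x) h
        (hausdorffEDist_ne_top_of_nonempty_of_bounded ⟨_, mem_range_self x⟩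
          (hB.mono (subset_univ _) |>.image ψ |>.mono (image_subset_range _ _)) bφ bψ)
      exact ⟨y, hd, fun h => absurd h hxA⟩
  choose a ha ha' using hx
  exact ⟨a, ha, fun x hx => ha' x hx⟩

/-- For a bounded distance function, points of `S` lie within any number larger than the
Hausdorff distance from `T`. -/
theorem exists_lt_of_hausdorffDistWrt_lt {Z : Type*} {d : Z → Z → ℝ} {C r : ℝ}
    (h0 : ∀ p q, 0 ≤ d p q) (hC : ∀ p q, d p q ≤ C) {S T : Set Z} (hS : S.Nonempty)
    (hT : T.Nonempty) (h : hausdorffDistWrt d S T < r) :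
    (∀ s ∈ S, ∃ t ∈ T, d s t < r) ∧ ∀ t ∈ T, ∃ s ∈ S, d s t < r := by
  have := hS.to_subtype
  have := hT.to_subtype
  obtain ⟨h1, h2⟩ := max_lt_iff.1 h
  constructor
  · intro s hs
    have hb : BddAbove (range fun s : S => ⨅ t : T, d s t) := by
      refine ⟨C, ?_⟩
      rintro _ ⟨s, rfl⟩
      exact (ciInf_le ⟨0, by rintro _ ⟨t, rfl⟩; exact h0 _ _⟩ (Classical.arbitrary T)).trans (hC _ _)
    obtain ⟨t, ht⟩ := exists_lt_of_ciInf_lt ((le_ciSup hb ⟨s, hs⟩).trans_lt h1)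
    exact ⟨t, t.2, ht⟩
  · intro t ht
    have hb : BddAbove (range fun t : T => ⨅ s : S, d s t) := by
      refine ⟨C, ?_⟩
      rintro _ ⟨s, rfl⟩
      exact (ciInf_le ⟨0, by rintro _ ⟨t, rfl⟩; exact h0 _ _⟩ (Classical.arbitrary S)).trans (hC _ _)
    obtain ⟨s, hs⟩ := exists_lt_of_ciInf_lt ((le_ciSup hb ⟨t, ht⟩).trans_lt h2)
    exact ⟨s, s.2, hs⟩

theorem hausdorffDistWrt_nonneg {Z : Type*} {d : Z → Z → ℝ} (h0 : ∀ p q, 0 ≤ d p q)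
    (S T : Set Z) : 0 ≤ hausdorffDistWrt d S T :=
  le_max_of_le_left (Real.iSup_nonneg fun _ => Real.iInf_nonneg fun _ => h0 _ _)

namespace AdmissibleMetric

variable {X Y : Type*} [MetricSpace X] [MetricSpace Y]

theorem nonneg (δ : AdmissibleMetric X Y) (p q : X ⊕ Y) : 0 ≤ δ.d p q := by
  have h1 := δ.triangle p q p
  rw [δ.refl, δ.symm q p] at h1
  linarith

/-- The pseudometric structure on the disjoint union given by an admissible metric. -/
abbrev toPseudoMetricSpace (δ : AdmissibleMetric X Y) : PseudoMetricSpace (X ⊕ Y) where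
  dist := δ.d
  dist_self := δ.refl
  dist_comm := δ.symm
  dist_triangle := δ.triangle

theorem exists_bound [CompactSpace X] [CompactSpace Y] [Nonempty X] [Nonempty Y]
    (δ : AdmissibleMetric X Y) : ∃ C, ∀ p q, δ.d p q ≤ C := by
  obtain ⟨x₀⟩ := ‹Nonempty X›
  obtain ⟨y₀⟩ := ‹Nonempty Y›
  have hx : ∀ x : X, dist x x₀ ≤ diam (univ : Set X) := fun x =>
    dist_le_diam_of_mem isCompact_univ.isBounded (mem_univ _) (mem_univ _)
  have hy : ∀ y : Y, dist y y₀ ≤ diam (univ : Set Y) := fun y =>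
    dist_le_diam_of_mem isCompact_univ.isBounded (mem_univ _) (mem_univ _)
  set c := diam (univ : Set X) + (diam (univ : Set Y) + δ.d (.inr y₀) (.inl x₀))
  have key : ∀ p, δ.d p (.inl x₀) ≤ c := by
    rintro (x | y)
    · rw [δ.restr_left]
      linarith [hx x, δ.nonneg (.inr y₀) (.inl x₀), diam_nonneg (s := (univ : Set Y))]
    · have := δ.triangle (.inr y) (.inr y₀) (.inl x₀)
      rw [δ.restr_right] at this
      linarith [hy y, diam_nonneg (s := (univ : Set X))]
  refine ⟨c + c, fun p q => (δ.triangle p (.inl x₀) q).trans ?_⟩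
  rw [δ.symm (.inl x₀) q]
  exact add_le_add (key p) (key q)

theorem nonempty [Nonempty X] [Nonempty Y] : Nonempty (AdmissibleMetric X Y) := by
  let := Metric.metricSpaceSum (X := X) (Y := Y)
  exact ⟨{ d := dist
           refl := dist_self
           pos := fun p q h => dist_pos.2 h
           symm := dist_comm
           triangle := dist_triangle
           restr_left := fun x x' => Metric.isometry_inl.dist_eq x x'
           restr_right := fun y y' => Metric.isometry_inr.dist_eq y y' }⟩

end AdmissibleMetric

section Gluing

variable {I : Type*} {X : I → Type*} {Z : Type*} [∀ i, MetricSpace (X i)] [MetricSpace Z]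

/-- The inclusion of `X i ⊕ Z` into the union of all the `X i` and `Z`. -/
def gluingIncl (i : I) : X i ⊕ Z → Z ⊕ Σ i, X i :=
  Sum.elim (fun x => .inr ⟨i, x⟩) .inl

/-- The real functions on the union of all the `X i` and `Z` that are `1`-Lipschitz
on each `X i ⊕ Z`. -/
def IsGluingPotential (δ : ∀ i, AdmissibleMetric (X i) Z) (u : (Z ⊕ Σ i, X i) → ℝ) : Prop :=
  ∀ i p q, u (gluingIncl i p) - u (gluingIncl i q) ≤ (δ i).d p q

theorem exists_isGluingPotential (δ : ∀ i, AdmissibleMetric (X i) Z) (i : I) (p : X i ⊕ Z) :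
    ∃ u, IsGluingPotential δ u ∧ ∀ q, u (gluingIncl i q) = (δ i).d q p := by
  have hext : ∀ j, ∃ v : X j ⊕ Z → ℝ, (∀ q r, v q - v r ≤ (δ j).d q r) ∧
      (∀ z, v (.inr z) = (δ i).d (.inr z) p) ∧
      ∀ (h : i = j) (x : X i), v (.inl (h ▸ x)) = (δ i).d (.inl x) p := by
    intro j
    by_cases h : i = j
    · subst h
      exact ⟨fun q => (δ i).d q p, fun q r => by linarith [(δ i).triangle q r p],
        fun _ => rfl, fun _ _ => rfl⟩
    · let := (δ j).toPseudoMetricSpace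
      have hL : LipschitzOnWith 1 (Sum.elim (fun _ => 0) fun z => (δ i).d (.inr z) p)
          (range (Sum.inr : Z → X j ⊕ Z)) := by
        refine LipschitzOnWith.of_le_add ?_
        rintro _ ⟨z, rfl⟩ _ ⟨w, rfl⟩
        change (δ i).d (.inr z) p ≤ (δ i).d (.inr w) p + (δ j).d (.inr z) (.inr w)
        have := (δ i).triangle (.inr z) (.inr w) p
        rw [(δ i).restr_right] at this
        rw [(δ j).restr_right]
        linarith
      obtain ⟨v, hv, hveq⟩ := hL.extend_real
      refine ⟨v, fun q r => ?_, fun z => (hveq (mem_range_self z)).symm, fun h' => absurd h' h⟩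
      have := hv.le_add_mul q r
      change v q ≤ v r + _ * (δ j).d q r at this
      simp only [NNReal.coe_one, one_mul] at this
      linarith
  choose v hv hvZ hvX using hext
  refine ⟨Sum.elim (fun z => (δ i).d (.inr z) p) fun s => v s.1 (.inl s.2), ?_, ?_⟩
  · intro j q r
    have key : ∀ q : X j ⊕ Z, Sum.elim (fun z => (δ i).d (.inr z) p)
        (fun s : Σ i, X i => v s.1 (.inl s.2)) (gluingIncl j q) = v j q := by
      rintro (x | z)
      · rfl
      · exact (hvZ j z).symm
    rw [key, key]
    exact hv j q r
  · rintro (x | z)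
    · exact hvX i rfl x
    · rfl

/-- The distance on the union of all the `X i` and `Z` obtained by gluing along `Z`. -/
noncomputable def gluingDist (δ : ∀ i, AdmissibleMetric (X i) Z) (p q : Z ⊕ Σ i, X i) : ℝ :=
  ⨆ u : {u // IsGluingPotential δ u}, u.1 p - u.1 q

variable [Nonempty I] [Nonempty Z]

instance (δ : ∀ i, AdmissibleMetric (X i) Z) : Nonempty {u // IsGluingPotential δ u} := by
  obtain ⟨i⟩ := ‹Nonempty I›
  obtain ⟨z⟩ := ‹Nonempty Z›
  obtain ⟨u, hu, -⟩ := exists_isGluingPotential δ i (.inr z)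
  exact ⟨u, hu⟩

theorem bddAbove_gluing (δ : ∀ i, AdmissibleMetric (X i) Z) (p q : Z ⊕ Σ i, X i) :
    BddAbove (range fun u : {u // IsGluingPotential δ u} => u.1 p - u.1 q) := by
  obtain ⟨i₀⟩ := ‹Nonempty I›
  obtain ⟨z₀⟩ := ‹Nonempty Z›
  have key : ∀ p : Z ⊕ Σ i, X i, ∃ C, ∀ u : {u // IsGluingPotential δ u},
      u.1 p - u.1 (.inl z₀) ≤ C ∧ u.1 (.inl z₀) - u.1 p ≤ C := by
    have aux : ∀ i (p : X i ⊕ Z), ∃ C, ∀ u : {u // IsGluingPotential δ u},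
        u.1 (gluingIncl i p) - u.1 (.inl z₀) ≤ C ∧ u.1 (.inl z₀) - u.1 (gluingIncl i p) ≤ C :=
      fun i p => ⟨(δ i).d p (.inr z₀), fun u =>
        ⟨u.2 i p (.inr z₀), by rw [(δ i).symm]; exact u.2 i (.inr z₀) p⟩⟩
    rintro (z | ⟨i, x⟩)
    · exact aux i₀ (.inr z)
    · exact aux i (.inl x)
  obtain ⟨C, hC⟩ := key p
  obtain ⟨C', hC'⟩ := key q
  refine ⟨C + C', ?_⟩
  rintro _ ⟨u, rfl⟩
  have h1 := (hC u).1
  have h2 := (hC' u).2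
  change u.1 p - u.1 q ≤ _
  linarith

theorem gluingDist_incl (δ : ∀ i, AdmissibleMetric (X i) Z) (i : I) (p q : X i ⊕ Z) :
    gluingDist δ (gluingIncl i p) (gluingIncl i q) = (δ i).d p q := by
  refine le_antisymm (ciSup_le fun u => u.2 i p q) ?_
  obtain ⟨u, hu, hq⟩ := exists_isGluingPotential δ i q
  refine le_trans ?_ (le_ciSup (bddAbove_gluing δ _ _) ⟨u, hu⟩)
  simp [hq, (δ i).refl]

/-- The union of all the `X i` and `Z`, as a space to be endowed with the glued distance. -/
def GluedSpace (_ : ∀ i, AdmissibleMetric (X i) Z) := Z ⊕ Σ i, X i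

noncomputable instance (δ : ∀ i, AdmissibleMetric (X i) Z) : PseudoMetricSpace (GluedSpace δ) where
  dist := gluingDist δ
  dist_self p := by
    change (⨆ u : {u // IsGluingPotential δ u}, u.1 p - u.1 p) = 0
    simp
  dist_comm p q := by
    have key : ∀ p q, gluingDist δ p q ≤ gluingDist δ q p := fun p q =>
      ciSup_le fun u => by
        have hneg : IsGluingPotential δ (-u.1) := fun i a b => by
          have := u.2 i b a
          rw [(δ i).symm] at this
          simp only [Pi.neg_apply]
          linarith
        refine le_trans ?_ (le_ciSup (bddAbove_gluing δ q p) ⟨_, hneg⟩)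
        simp
    exact le_antisymm (key p q) (key q p)
  dist_triangle p q r := ciSup_le fun u => by
    have h1 := le_ciSup (bddAbove_gluing δ p q) u
    have h2 := le_ciSup (bddAbove_gluing δ q r) u
    change _ ≤ gluingDist δ p q + gluingDist δ q r
    simp only [gluingDist]
    linarith

/-- Metric spaces that are each at an admissible distance from `Z` embed isometrically, together
with `Z`, into a common metric space inducing all these admissible distances. -/
theorem exists_isometry_gluing (δ : ∀ i, AdmissibleMetric (X i) Z) :
    ∃ (φ : ∀ i, X i → SeparationQuotient (GluedSpace δ))
      (φinf : Z → SeparationQuotient (GluedSpace δ)),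
      (∀ i, Isometry (φ i)) ∧ Isometry φinf ∧
      ∀ i x z, dist (φ i x) (φinf z) = (δ i).d (.inl x) (.inr z) := by
  refine ⟨fun i x => SeparationQuotient.mk (gluingIncl i (.inl x) : Z ⊕ Σ i, X i),
    fun z => SeparationQuotient.mk (.inl z : Z ⊕ Σ i, X i), fun i => ?_, ?_, fun i x z => ?_⟩
  · refine Isometry.of_dist_eq fun x y => ?_
    exact (gluingDist_incl δ i (.inl x) (.inl y)).trans ((δ i).restr_left x y)
  · obtain ⟨i⟩ := ‹Nonempty I›
    refine Isometry.of_dist_eq fun x y => ?_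
    exact (gluingDist_incl δ i (.inr x) (.inr y)).trans ((δ i).restr_right x y)
  · exact gluingDist_incl δ i (.inl x) (.inr z)

end Gluing

theorem MetricPair.exists_admissibleMetric (P Q : MetricPair) {r : ℝ}
    (h : MetricPair.ghDist P Q < r) :
    ∃ δ : AdmissibleMetric P.carrier Q.carrier, pairHausdorffDist δ P.A Q.A < r := by
  have : Nonempty P.carrier := P.hne.to_type
  have : Nonempty Q.carrier := Q.hne.to_type
  obtain ⟨δ₀⟩ := AdmissibleMetric.nonempty (X := P.carrier) (Y := Q.carrier)
  have hne : {r | ∃ δ : AdmissibleMetric P.carrier Q.carrier,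
      r = pairHausdorffDist δ P.A Q.A}.Nonempty := ⟨_, δ₀, rfl⟩
  obtain ⟨_, ⟨δ, rfl⟩, hδ⟩ := exists_lt_of_csInf_lt hne h
  exact ⟨δ, hδ⟩

open Filter Topology in
/-- A Gromov–Hausdorff convergent sequence of compact metric pairs can be embedded isometrically,
together with its limit, into a metric pair in which it converges in the Hausdorff sense. -/
theorem MetricPair.exists_ambientPair (P : ℕ → MetricPair) (Pinf : MetricPair)
    (h : Tendsto (fun i => MetricPair.ghDist (P i) Pinf) atTop (𝓝 0)) :
    ∃ (W : AmbientPair) (φ : ∀ i, (P i).carrier → W.carrier) (φinf : Pinf.carrier → W.carrier),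
      (∀ i, Isometry (φ i)) ∧ Isometry φinf ∧
      (∀ i, MapsTo (φ i) (P i).A W.A) ∧ MapsTo φinf Pinf.A W.A ∧
      Tendsto (fun i => hausdorffDist (range (φ i)) (range φinf)) atTop (𝓝 0) ∧
      Tendsto (fun i => hausdorffDist (φ i '' (P i).A) (φinf '' Pinf.A)) atTop (𝓝 0) := by
  have hne : ∀ P : MetricPair, Nonempty P.carrier := fun P => P.hne.to_type
  set r : ℕ → ℝ := fun i => MetricPair.ghDist (P i) Pinf + 1 / ((i : ℝ) + 1) with hr
  have hr0 : Tendsto r atTop (𝓝 0) := by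
    simpa [hr] using h.add tendsto_one_div_add_atTop_nhds_zero_nat
  choose δ hδ using fun i => MetricPair.exists_admissibleMetric (P i) Pinf
    (r := r i) (lt_add_of_pos_right _ (by positivity))
  obtain ⟨φ, φinf, hφ, hφinf, hdist⟩ := exists_isometry_gluing δ
  have hclose : ∀ i, hausdorffDist (range (φ i)) (range φinf) ≤ r i ∧
      hausdorffDist (φ i '' (P i).A) (φinf '' Pinf.A) ≤ r i := by
    intro i
    obtain ⟨C, hC⟩ := (δ i).exists_bound
    have hn1 := hausdorffDistWrt_nonneg (δ i).nonneg (range Sum.inl) (range Sum.inr)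
    have hn2 := hausdorffDistWrt_nonneg (δ i).nonneg (Sum.inl '' (P i).A) (Sum.inr '' Pinf.A)
    have hsum : hausdorffDistWrt (δ i).d (range Sum.inl) (range Sum.inr) +
      hausdorffDistWrt (δ i).d (Sum.inl '' (P i).A) (Sum.inr '' Pinf.A) < r i := hδ i
    have hr0 : 0 ≤ r i := by linarith
    obtain ⟨h1, h2⟩ := exists_lt_of_hausdorffDistWrt_lt (δ i).nonneg hC (range_nonempty _)
      (range_nonempty _) (show hausdorffDistWrt (δ i).d (range Sum.inl) (range Sum.inr) < r i by
        linarith)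
    obtain ⟨h3, h4⟩ := exists_lt_of_hausdorffDistWrt_lt (δ i).nonneg hC ((P i).hne.image _)
      (Pinf.hne.image _)
      (show hausdorffDistWrt (δ i).d (Sum.inl '' (P i).A) (Sum.inr '' Pinf.A) < r i by linarith)
    constructor
    · refine hausdorffDist_le_of_mem_dist hr0 ?_ ?_
      · rintro _ ⟨x, rfl⟩
        obtain ⟨_, ⟨z, rfl⟩, hz⟩ := h1 _ (mem_range_self x)
        exact ⟨_, mem_range_self z, (hdist i x z).trans_le hz.le⟩
      · rintro _ ⟨z, rfl⟩
        obtain ⟨_, ⟨x, rfl⟩, hx⟩ := h2 _ (mem_range_self z)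
        exact ⟨_, mem_range_self x, by rw [dist_comm]; exact (hdist i x z).trans_le hx.le⟩
    · refine hausdorffDist_le_of_mem_dist hr0 ?_ ?_
      · rintro _ ⟨x, hxA, rfl⟩
        obtain ⟨_, ⟨z, hzA, rfl⟩, hz⟩ := h3 _ (mem_image_of_mem _ hxA)
        exact ⟨_, mem_image_of_mem _ hzA, (hdist i x z).trans_le hz.le⟩
      · rintro _ ⟨z, hzA, rfl⟩
        obtain ⟨_, ⟨x, hxA, rfl⟩, hx⟩ := h4 _ (mem_image_of_mem _ hzA)
        exact ⟨_, mem_image_of_mem _ hxA, by rw [dist_comm]; exact (hdist i x z).trans_le hx.le⟩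
  refine ⟨{ carrier := SeparationQuotient (GluedSpace δ)
            A := closure (φinf '' Pinf.A ∪ ⋃ i, φ i '' (P i).A)
            hne := ((Pinf.hne.image φinf).mono subset_union_left).closure
            hcl := isClosed_closure }, φ, φinf, hφ, hφinf, fun i x hx => ?_, fun x hx => ?_, ?_, ?_⟩
  · exact subset_closure (.inr (mem_iUnion.2 ⟨i, mem_image_of_mem _ hx⟩))
  · exact subset_closure (.inl (mem_image_of_mem _ hx))
  · exact squeeze_zero (fun _ => hausdorffDist_nonneg) (fun i => (hclose i).1) hr0
  · exact squeeze_zero (fun _ => hausdorffDist_nonneg) (fun i => (hclose i).2) hr0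

open Filter Topology in
/-- Arzelà–Ascoli for compact metric pairs. Given compact metric pairs
`(X_i, A_i) → (X_∞, A_∞)` and `(Y_i, B_i) → (Y_∞, B_∞)` in the Gromov–Hausdorff sense, and
equicontinuous relative maps `f_i : (X_i, A_i) → (Y_i, B_i)`, some subsequence of `(f_i)`
converges relatively uniformly — via isometric embeddings of all pairs into common ambient
metric pairs realizing the Gromov–Hausdorff convergence — to a continuous relative map
`f_∞ : (X_∞, A_∞) → (Y_∞, B_∞)`. Moreover, if `Lip(f_i) ≤ K` for all `i` then `Lip(f_∞) ≤ K`,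
and if `Lip(f_i|_{A_i}) ≤ L` for all `i` then `Lip(f_∞|_{A_∞}) ≤ L`. -/
theorem arzela_ascoli_metricPair
    (P : ℕ → MetricPair) (Pinf : MetricPair) (Q : ℕ → MetricPair) (Qinf : MetricPair)
    (hPconv : Tendsto (fun i => MetricPair.ghDist (P i) Pinf) atTop (𝓝 0))
    (hQconv : Tendsto (fun i => MetricPair.ghDist (Q i) Qinf) atTop (𝓝 0))
    (f : ∀ i : ℕ, (P i).carrier → (Q i).carrier)
    (hrel : ∀ i, Set.MapsTo (f i) (P i).A (Q i).A)
    (hequi : ∀ ε : ℝ, 0 < ε → ∃ δ : ℝ, 0 < δ ∧ ∀ i, ∀ x y : (P i).carrier,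
      dist x y < δ → dist (f i x) (f i y) < ε) :
    ∃ ι : ℕ → ℕ, StrictMono ι ∧ ∃ finf : Pinf.carrier → Qinf.carrier,
      Continuous finf ∧ Set.MapsTo finf Pinf.A Qinf.A ∧
      -- the subsequence `f_{ι i}` converges relatively uniformly to `f_∞`, via isometric
      -- embeddings into common ambient metric pairs realizing the GH convergence:
      (∃ (W Z : AmbientPair)
          (φ : ∀ i, (P (ι i)).carrier → W.carrier) (φinf : Pinf.carrier → W.carrier)
          (ψ : ∀ i, (Q (ι i)).carrier → Z.carrier) (ψinf : Qinf.carrier → Z.carrier),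
        (∀ i, Isometry (φ i)) ∧ Isometry φinf ∧
        (∀ i, Isometry (ψ i)) ∧ Isometry ψinf ∧
        (∀ i, Set.MapsTo (φ i) (P (ι i)).A W.A) ∧ Set.MapsTo φinf Pinf.A W.A ∧
        (∀ i, Set.MapsTo (ψ i) (Q (ι i)).A Z.A) ∧ Set.MapsTo ψinf Qinf.A Z.A ∧
        Tendsto (fun i => Metric.hausdorffDist (Set.range (φ i)) (Set.range φinf))
          atTop (𝓝 0) ∧
        Tendsto (fun i => Metric.hausdorffDist (φ i '' (P (ι i)).A) (φinf '' Pinf.A))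
          atTop (𝓝 0) ∧
        Tendsto (fun i => Metric.hausdorffDist (Set.range (ψ i)) (Set.range ψinf))
          atTop (𝓝 0) ∧
        Tendsto (fun i => Metric.hausdorffDist (ψ i '' (Q (ι i)).A) (ψinf '' Qinf.A))
          atTop (𝓝 0) ∧
        ∀ ε : ℝ, 0 < ε → ∃ N : ℕ, ∃ η : ℝ, 0 < η ∧
          ∀ i, N ≤ i → ∀ x : (P (ι i)).carrier, ∀ xinf : Pinf.carrier,
            dist (φ i x) (φinf xinf) < η →
            dist (ψ i (f (ι i) x)) (ψinf (finf xinf)) < ε) ∧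
      -- if `Lip(f_i) ≤ K` for all `i`, then `Lip(f_∞) ≤ K`:
      (∀ K : ℝ, (∀ i, ∀ x y : (P i).carrier, dist (f i x) (f i y) ≤ K * dist x y) →
        ∀ x y : Pinf.carrier, dist (finf x) (finf y) ≤ K * dist x y) ∧
      -- if `Lip(f_i|_{A_i}) ≤ L` for all `i`, then `Lip(f_∞|_{A_∞}) ≤ L`:
      (∀ L : ℝ, (∀ i, ∀ x ∈ (P i).A, ∀ y ∈ (P i).A, dist (f i x) (f i y) ≤ L * dist x y) →
        ∀ x ∈ Pinf.A, ∀ y ∈ Pinf.A, dist (finf x) (finf y) ≤ L * dist x y) := by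
  obtain ⟨W, φ, φinf, hφ, hφinf, hφA, hφinfA, hW, hWA⟩ :=
    MetricPair.exists_ambientPair P Pinf hPconv
  obtain ⟨Z, ψ, ψinf, hψ, hψinf, hψA, hψinfA, hZ, hZA⟩ :=
    MetricPair.exists_ambientPair Q Qinf hQconv
  obtain ⟨e, he, hWe, hWAe, hZe, hZAe⟩ : ∃ e : ℕ → ℝ, Tendsto e atTop (𝓝 0) ∧
      (∀ i, hausdorffDist (range (φ i)) (range φinf) < e i) ∧
      (∀ i, hausdorffDist (φ i '' (P i).A) (φinf '' Pinf.A) < e i) ∧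
      (∀ i, hausdorffDist (range (ψ i)) (range ψinf) < e i) ∧
      (∀ i, hausdorffDist (ψ i '' (Q i).A) (ψinf '' Qinf.A) < e i) := by
    refine ⟨fun i => hausdorffDist (range (φ i)) (range φinf) +
      hausdorffDist (φ i '' (P i).A) (φinf '' Pinf.A) +
      hausdorffDist (range (ψ i)) (range ψinf) +
      hausdorffDist (ψ i '' (Q i).A) (ψinf '' Qinf.A) + 1 / ((i : ℝ) + 1), ?_, ?_, ?_, ?_, ?_⟩
    · simpa using (((hW.add hWA).add hZ).add hZA).add tendsto_one_div_add_atTop_nhds_zero_nat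
    all_goals
      intro i
      have h1 := hausdorffDist_nonneg (s := range (φ i)) (t := range φinf)
      have h2 := hausdorffDist_nonneg (s := φ i '' (P i).A) (t := φinf '' Pinf.A)
      have h3 := hausdorffDist_nonneg (s := range (ψ i)) (t := range ψinf)
      have h4 := hausdorffDist_nonneg (s := ψ i '' (Q i).A) (t := ψinf '' Qinf.A)
      have h5 : 0 < 1 / ((i : ℝ) + 1) := by positivity
      linarith
  choose a ha haA using fun i => exists_relative_map_dist_lt hφinf (hφ i) Pinf.hne (P i).hne
    (by rw [hausdorffDist_comm]; exact hWe i) (by rw [hausdorffDist_comm]; exact hWAe i)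
  choose b hb hbA using fun i => exists_relative_map_dist_lt (hψ i) hψinf (Q i).hne Qinf.hne
    (hZe i) (hZAe i)
  have hda : ∀ i x y, dist (a i x) (a i y) ≤ dist x y + 2 * e i := by
    intro i x y
    rw [← (hφ i).dist_eq, ← hφinf.dist_eq]
    have := dist_triangle4 (φ i (a i x)) (φinf x) (φinf y) (φ i (a i y))
    rw [dist_comm (φ i (a i x)) (φinf x)] at this
    linarith [ha i x, ha i y]
  have hdb : ∀ i x y, dist (b i x) (b i y) ≤ dist x y + 2 * e i := by
    intro i x y
    rw [← (hψ i).dist_eq, ← hψinf.dist_eq]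
    have := dist_triangle4 (ψinf (b i x)) (ψ i x) (ψ i y) (ψinf (b i y))
    rw [dist_comm (ψinf (b i x)) (ψ i x)] at this
    linarith [hb i x, hb i y]
  have hsmall : ∀ ε : ℝ, 0 < ε → ∃ N, ∀ i, N ≤ i → e i < ε := fun ε hε =>
    eventually_atTop.1 (he.eventually (gt_mem_nhds hε))
  obtain ⟨ι, hι, finf, hfc, hunif⟩ :=
    exists_subseq_tendstoUniformly_of_asymptotic_equicontinuous
      (fun i x => b i (f i (a i x))) (by
        intro ε hε
        obtain ⟨δ, hδ, hf⟩ := hequi (ε / 2) (by positivity)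
        obtain ⟨N, hN⟩ := hsmall (min (δ / 4) (ε / 4)) (by positivity)
        refine ⟨δ / 2, by positivity, N, fun i hi x y hxy => ?_⟩
        obtain ⟨h1, h2⟩ := lt_min_iff.1 (hN i hi)
        have h3 := hf i (a i x) (a i y) (by linarith [hda i x y])
        linarith [hdb i (f i (a i x)) (f i (a i y))])
  have hpt : ∀ x, Tendsto (fun i => b (ι i) (f (ι i) (a (ι i) x))) atTop (𝓝 (finf x)) :=
    fun x => hunif.tendsto_at x
  have heι : Tendsto (fun i => e (ι i)) atTop (𝓝 0) := he.comp hι.tendsto_atTop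
  have hdaι : ∀ x y, Tendsto (fun i => dist (a (ι i) x) (a (ι i) y)) atTop (𝓝 (dist x y)) := by
    intro x y
    have hlow : ∀ i, dist x y - 2 * e i ≤ dist (a i x) (a i y) := by
      intro i
      rw [← (hφ i).dist_eq, ← hφinf.dist_eq]
      have := dist_triangle4 (φinf x) (φ i (a i x)) (φ i (a i y)) (φinf y)
      rw [dist_comm (φ i (a i y)) (φinf y)] at this
      linarith [ha i x, ha i y]
    refine tendsto_of_tendsto_of_tendsto_of_le_of_le ?_ ?_ (fun i => hlow (ι i))
      (fun i => hda (ι i) x y)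
    · simpa using tendsto_const_nhds.sub (heι.const_mul 2)
    · simpa using tendsto_const_nhds.add (heι.const_mul 2)
  have hlip : ∀ (K : ℝ) (x y : Pinf.carrier),
      (∀ i, dist (f i (a i x)) (f i (a i y)) ≤ K * dist (a i x) (a i y)) →
      dist (finf x) (finf y) ≤ K * dist x y := by
    intro K x y hK
    have hlim : Tendsto (fun i => K * dist (a (ι i) x) (a (ι i) y) + 2 * e (ι i)) atTop
        (𝓝 (K * dist x y)) := by
      simpa using ((hdaι x y).const_mul K).add (heι.const_mul 2)
    exact le_of_tendsto_of_tendsto' ((hpt x).dist (hpt y)) hlim fun i =>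
      (hdb (ι i) _ _).trans (add_le_add_left (hK (ι i)) _)
  refine ⟨ι, hι, finf, hfc, fun x hx => ?_, ⟨W, Z, fun i => φ (ι i), φinf, fun i => ψ (ι i), ψinf,
    fun i => hφ _, hφinf, fun i => hψ _, hψinf, fun i => hφA _, hφinfA, fun i => hψA _, hψinfA,
    hW.comp hι.tendsto_atTop, hWA.comp hι.tendsto_atTop, hZ.comp hι.tendsto_atTop,
    hZA.comp hι.tendsto_atTop, ?_⟩, ?_, ?_⟩
  · exact Qinf.hcl.mem_of_tendsto (hpt x)
      (Eventually.of_forall fun i => hbA _ (hrel _ (haA _ hx)))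
  · intro ε hε
    obtain ⟨δ, hδ, hf⟩ := hequi (ε / 3) (by positivity)
    obtain ⟨N, hN⟩ := hsmall (min (δ / 2) (ε / 3)) (by positivity)
    obtain ⟨M, hM⟩ := eventually_atTop.1
      (Metric.tendstoUniformly_iff.1 hunif (ε / 3) (by positivity))
    refine ⟨max M N, δ / 2, by positivity, fun i hi x z hxz => ?_⟩
    obtain ⟨h1, h2⟩ := lt_min_iff.1 (hN (ι i) ((le_of_max_le_right hi).trans hι.le_apply))
    have h3 : dist x (a (ι i) z) < δ := by
      rw [← (hφ _).dist_eq]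
      linarith [dist_triangle (φ (ι i) x) (φinf z) (φ (ι i) (a (ι i) z)), ha (ι i) z]
    have h4 := hf _ _ _ h3
    have h5 := hb (ι i) (f (ι i) (a (ι i) z))
    have h6 := hM i (le_of_max_le_left hi) z
    rw [dist_comm, ← hψinf.dist_eq] at h6
    rw [← (hψ _).dist_eq] at h4
    linarith [dist_triangle4 (ψ (ι i) (f (ι i) x)) (ψ (ι i) (f (ι i) (a (ι i) z)))
      (ψinf (b (ι i) (f (ι i) (a (ι i) z)))) (ψinf (finf z))]
  · exact fun K hK x y => hlip K x y fun i => hK i _ _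
  · exact fun L hL x hx y hy => hlip L x y fun i => hL i _ (haA i hx) _ (haA i hy)
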